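/- Let D ⊆ ℝ³ be a bounded measurable set, ρ ∈ ℝ³ a unit vector, and h_D(ρ) = sup_{x ∈ D} x·ρ its support function in direction ρ. Suppose there is a constant C₁ > 0 such that vol({x ∈ D : x·ρ > h_D(ρ) − s}) ≤ C₁ s² for all s > 0. Then limsup_{τ→∞} τ² ∫_D e^{2τ(x·ρ − h_D(ρ))} dx ≤ C₁/2. -/

import Mathlib

open Filter MeasureTheory
open scoped RealInnerProductSpace

/-- An exponential tail is the mass of its own density. -/
lemma lintegral_Ioi_ofReal_mul_exp_neg {a : ℝ} (ha : 0 < a) (c : ℝ) :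
    ∫⁻ s in Set.Ioi c, ENNReal.ofReal (a * Real.exp (-a * s)) =
      ENNReal.ofReal (Real.exp (-a * c)) := by
  rw [← ofReal_integral_eq_lintegral_ofReal
    ((integrableOn_exp_mul_Ioi (neg_neg_of_pos ha) c).const_mul a)
    (ae_of_all _ fun s => by positivity), integral_const_mul,
    integral_exp_mul_Ioi (neg_neg_of_pos ha)]
  congr 1
  field_simp

lemma lintegral_Ioi_ofReal_sq_mul_exp_neg {a : ℝ} (ha : 0 < a) :
    ∫⁻ s in Set.Ioi (0 : ℝ), ENNReal.ofReal (s ^ 2 * Real.exp (-a * s)) =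
      ENNReal.ofReal (2 / a ^ 3) := by
  have h : ∫ s in Set.Ioi (0 : ℝ), s ^ 2 * Real.exp (-a * s) = 2 / a ^ 3 := by
    have h := Real.integral_rpow_mul_exp_neg_mul_Ioi (a := 3) (by norm_num) ha
    have hΓ : Real.Gamma 3 = 2 := by
      rw [show (3 : ℝ) = (2 : ℕ) + 1 by norm_num, Real.Gamma_nat_eq_factorial]
      norm_num
    rw [hΓ, show (3 : ℝ) - 1 = (2 : ℕ) by norm_num] at h
    simp only [Real.rpow_natCast, ← neg_mul] at h
    rw [h, show (3 : ℝ) = (3 : ℕ) by norm_num, Real.rpow_natCast]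
    field_simp
  rw [← h, ofReal_integral_eq_lintegral_ofReal]
  · exact Integrable.of_integral_ne_zero (by rw [h]; positivity)
  · exact ae_of_all _ fun s => by positivity

/-- A quadratic bound on the sublevel sets of a nonnegative function bounds its Laplace
transform. -/
lemma lintegral_exp_neg_le_of_sublevel_sq {α : Type*} [MeasurableSpace α] {μ : Measure α}
    [SFinite μ] {u : α → ℝ} (hu : Measurable u) (hu0 : ∀ᵐ x ∂μ, 0 ≤ u x) {a C : ℝ}
    (ha : 0 < a) (hC : 0 ≤ C)
    (h : ∀ s, 0 < s → μ {x | u x < s} ≤ ENNReal.ofReal (C * s ^ 2)) :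
    ∫⁻ x, ENNReal.ofReal (Real.exp (-a * u x)) ∂μ ≤ ENNReal.ofReal (2 * C / a ^ 2) := by
  set g : ℝ → ENNReal := fun s => ENNReal.ofReal (a * Real.exp (-a * s)) with hg
  have hgm : Measurable g := by fun_prop
  have hS : MeasurableSet {p : α × ℝ | u p.1 < p.2} :=
    measurableSet_lt (hu.comp measurable_fst) measurable_snd
  calc ∫⁻ x, ENNReal.ofReal (Real.exp (-a * u x)) ∂μ
      = ∫⁻ x, (∫⁻ s in Set.Ioi 0,
          {p : α × ℝ | u p.1 < p.2}.indicator (fun p => g p.2) (x, s)) ∂μ := by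
        refine lintegral_congr_ae ?_
        filter_upwards [hu0] with x hx
        rw [← lintegral_Ioi_ofReal_mul_exp_neg ha,
          ← Set.inter_eq_left.mpr (Set.Ioi_subset_Ioi hx),
          ← Measure.restrict_restrict measurableSet_Ioi, ← lintegral_indicator measurableSet_Ioi]
        rfl
    _ = ∫⁻ s in Set.Ioi 0, ∫⁻ x, {p : α × ℝ | u p.1 < p.2}.indicator (fun p => g p.2) (x, s) ∂μ :=
        lintegral_lintegral_swap (f := fun x s =>
          {p : α × ℝ | u p.1 < p.2}.indicator (fun p => g p.2) (x, s)) ((hgm.comp measurable_snd).indicator hS).aemeasurable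
    _ = ∫⁻ s in Set.Ioi 0, g s * μ {x | u x < s} := by
        refine lintegral_congr fun s => ?_
        rw [← lintegral_indicator_const (measurableSet_lt hu measurable_const)]
        rfl
    _ ≤ ∫⁻ s in Set.Ioi 0,
          ENNReal.ofReal (a * C) * ENNReal.ofReal (s ^ 2 * Real.exp (-a * s)) := by
        refine setLIntegral_mono (by fun_prop) fun s hs => ?_
        refine (mul_le_mul_right (h s hs) _).trans_eq ?_
        rw [hg, ← ENNReal.ofReal_mul (by positivity), ← ENNReal.ofReal_mul (by positivity)]
        congr 1
        ring
    _ = ENNReal.ofReal (2 * C / a ^ 2) := by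
        rw [lintegral_const_mul _ (by fun_prop), lintegral_Ioi_ofReal_sq_mul_exp_neg ha,
          ← ENNReal.ofReal_mul (by positivity)]
        congr 1
        field_simp

/-- Upper bound matching Lemma 4.3: under the quadratic level-set bound
`vol({x ∈ D : x·ρ > h_D(ρ) - s}) ≤ C₁ s²` for all `s > 0`, one has
`limsup_{τ→∞} τ² ∫_D e^{2τ(x·ρ - h_D(ρ))} dx ≤ C₁/2`. -/
theorem stmt_8 (D : Set (EuclideanSpace ℝ (Fin 3))) (hDmeas : MeasurableSet D)
    (hDbdd : Bornology.IsBounded D)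
    (ρ : EuclideanSpace ℝ (Fin 3)) (hρ : ‖ρ‖ = 1)
    (hD : ℝ) (hhD : hD = sSup ((fun x => ⟪x, ρ⟫) '' D))
    (C₁ : ℝ) (hC₁ : 0 < C₁)
    (hvol : ∀ s : ℝ, 0 < s →
      volume {x ∈ D | hD - s < ⟪x, ρ⟫} ≤ ENNReal.ofReal (C₁ * s ^ 2)) :
    limsup (fun τ : ℝ => τ ^ 2 * ∫ x in D, Real.exp (2 * τ * (⟪x, ρ⟫ - hD))) atTop
      ≤ C₁ / 2 := by
  have hbdd : BddAbove ((fun x => ⟪x, ρ⟫) '' D) := by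
    obtain ⟨R, hR⟩ := hDbdd.exists_norm_le
    refine ⟨R, ?_⟩
    rintro _ ⟨x, hx, rfl⟩
    simpa [hρ] using (real_inner_le_norm x ρ).trans
      (mul_le_mul_of_nonneg_right (hR x hx) (norm_nonneg ρ))
  have hle : ∀ x ∈ D, ⟪x, ρ⟫ ≤ hD := fun x hx => hhD ▸ le_csSup hbdd ⟨x, hx, rfl⟩
  have hu : Measurable fun x : EuclideanSpace ℝ (Fin 3) => hD - ⟪x, ρ⟫ := by fun_prop
  refine limsup_le_of_le (isCoboundedUnder_le_of_le (x := 0) atTop fun τ => ?_) ?_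
  · exact mul_nonneg (sq_nonneg τ) (integral_nonneg fun x => (Real.exp_pos _).le)
  filter_upwards [eventually_gt_atTop 0] with τ hτ
  have key := lintegral_exp_neg_le_of_sublevel_sq (μ := volume.restrict D) hu
    ((ae_restrict_iff' hDmeas).mpr (ae_of_all _ fun x hx => sub_nonneg.mpr (hle x hx)))
    (a := 2 * τ) (by positivity) hC₁.le fun s hs => by
      rw [Measure.restrict_apply (measurableSet_lt hu measurable_const)]
      refine (measure_mono fun x hx => ?_).trans (hvol s hs)
      exact ⟨hx.2, sub_lt_comm.mp hx.1⟩
  have hint : ∫ x in D, Real.exp (2 * τ * (⟪x, ρ⟫ - hD)) ≤ 2 * C₁ / (2 * τ) ^ 2 := by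
    rw [integral_eq_lintegral_of_nonneg_ae (ae_of_all _ fun x => (Real.exp_pos _).le)
      (by fun_prop)]
    refine ENNReal.toReal_le_of_le_ofReal (by positivity) (le_trans (le_of_eq ?_) key)
    refine lintegral_congr fun x => ?_
    congr 2
    ring
  calc τ ^ 2 * ∫ x in D, Real.exp (2 * τ * (⟪x, ρ⟫ - hD))
      ≤ τ ^ 2 * (2 * C₁ / (2 * τ) ^ 2) := by gcongr
    _ = C₁ / 2 := by
        field_simp
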